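/- Under the batch-removal regularized-empirical-risk model and regularity assumptions, suppose additionally that there is a constant F > 0 such that ‖z_i‖ ≤ F and ‖z_i'‖ ≤ F for all i ∈ {1,…,n}, and the removal set S has size m. Then the gradient residual of the unlearned model satisfies ‖∇_w L(w', D')‖ ≤ 4 γ₂ m² C₁² F³ / (λ² n). -/

import Mathlib

open scoped InnerProductSpace BigOperators

/-- First-order Taylor remainder of a function whose derivative is `γ`-Lipschitz. -/
lemma abs_sub_sub_mul_le_of_lipschitz_deriv {f f' : ℝ → ℝ} {γ : ℝ} (hγ0 : 0 ≤ γ)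
    (hf : ∀ s, HasDerivAt f (f' s) s) (hγ : ∀ s t, |f' s - f' t| ≤ γ * |s - t|) (a b : ℝ) :
    |f b - f a - f' a * (b - a)| ≤ γ * |b - a| ^ 2 := by
  have hg : ∀ t ∈ Set.uIcc a b,
      HasDerivWithinAt (fun t => f t - f' a * t) (f' t - f' a) (Set.uIcc a b) t := fun t _ => by
    simpa using ((hf t).fun_sub ((hasDerivAt_id' t).const_mul (f' a))).hasDerivWithinAt
  have hbound : ∀ t ∈ Set.uIcc a b, ‖f' t - f' a‖ ≤ γ * |b - a| := fun t ht =>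
    (hγ t a).trans (mul_le_mul_of_nonneg_left (Set.abs_sub_left_of_mem_uIcc ht) hγ0)
  have h := (convex_uIcc a b).norm_image_sub_le_of_norm_hasDerivWithin_le hg hbound
    Set.left_mem_uIcc Set.right_mem_uIcc
  rw [Real.norm_eq_abs, Real.norm_eq_abs] at h
  calc |f b - f a - f' a * (b - a)| = |f b - f' a * b - (f a - f' a * a)| := by
        congr 1; ring
    _ ≤ γ * |b - a| * |b - a| := h
    _ = γ * |b - a| ^ 2 := by ring

/-- The gradient of a regularized empirical risk vanishes at a minimizer. -/
lemma sum_smul_add_smul_eq_zero_of_forall_le {ι E : Type*} [Fintype ι]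
    [NormedAddCommGroup E] [InnerProductSpace ℝ E] {φ φ' : ι → ℝ → ℝ}
    (hφ : ∀ i s, HasDerivAt (φ i) (φ' i s) s) (z : ι → E) (c : ℝ) (w₀ : E)
    (hmin : ∀ w : E, (∑ i, φ i ⟪w₀, z i⟫_ℝ) + c / 2 * ‖w₀‖ ^ 2 ≤
      (∑ i, φ i ⟪w, z i⟫_ℝ) + c / 2 * ‖w‖ ^ 2) :
    (∑ i, φ' i ⟪w₀, z i⟫_ℝ • z i) + c • w₀ = 0 := by
  set g := (∑ i, φ' i ⟪w₀, z i⟫_ℝ • z i) + c • w₀ with hg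
  have hline : HasDerivAt (fun t : ℝ => w₀ + t • g) g 0 := by
    simpa using ((hasDerivAt_id (0 : ℝ)).smul_const g).const_add w₀
  have hterm : ∀ i, HasDerivAt (fun t : ℝ => φ i ⟪w₀ + t • g, z i⟫_ℝ)
      (φ' i ⟪w₀, z i⟫_ℝ * ⟪g, z i⟫_ℝ) 0 := fun i => by
    have h1 : HasDerivAt (fun t : ℝ => ⟪w₀ + t • g, z i⟫_ℝ) ⟪g, z i⟫_ℝ 0 := by
      simpa using hline.inner ℝ (hasDerivAt_const (0 : ℝ) (z i))
    have h2 : HasDerivAt (φ i) (φ' i ⟪w₀, z i⟫_ℝ) ⟪w₀ + (0 : ℝ) • g, z i⟫_ℝ := by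
      simpa using hφ i ⟪w₀, z i⟫_ℝ
    exact h2.comp (0 : ℝ) h1
  have hrisk := (HasDerivAt.fun_sum fun i (_ : i ∈ Finset.univ) => hterm i).add
    (hline.norm_sq.const_mul (c / 2))
  have hzero := IsLocalMin.hasDerivAt_eq_zero
    (Filter.Eventually.of_forall fun t => by simpa using hmin (w₀ + t • g)) hrisk
  have hinner : ⟪g, g⟫_ℝ = 0 := by
    calc ⟪g, g⟫_ℝ = ⟪(∑ i, φ' i ⟪w₀, z i⟫_ℝ • z i) + c • w₀, g⟫_ℝ := by rw [← hg]
      _ = (∑ i, φ' i ⟪w₀, z i⟫_ℝ * ⟪g, z i⟫_ℝ) + c / 2 * (2 * ⟪w₀ + (0 : ℝ) • g, g⟫_ℝ) := by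
        rw [inner_add_left, sum_inner, real_inner_smul_left, zero_smul, add_zero]
        simp only [real_inner_smul_left, fun i => real_inner_comm g (z i)]
        ring
      _ = 0 := hzero
  exact inner_self_eq_zero.mp hinner

/-- Action of a weighted sum of rank-one matrices plus a multiple of the identity. -/
lemma toEuclideanLin_sum_smul_vecMulVec_add_smul_one {ι κ : Type*} [Fintype ι] [Fintype κ]
    [DecidableEq κ] (a : ι → ℝ) (z : ι → EuclideanSpace ℝ κ) (c : ℝ) (x : EuclideanSpace ℝ κ) :
    Matrix.toEuclideanLin ((∑ i, a i • Matrix.vecMulVec (z i) (z i)) +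
      c • (1 : Matrix κ κ ℝ)) x = (∑ i, (a i * ⟪x, z i⟫_ℝ) • z i) + c • x := by
  simp only [map_add, map_sum, map_smul, LinearMap.add_apply, LinearMap.sum_apply,
    LinearMap.smul_apply]
  congr 1
  · refine Finset.sum_congr rfl fun i _ => ?_
    rw [mul_smul]
    congr 1
    ext j
    simp [Matrix.toLpLin_apply, Matrix.vecMulVec_mulVec, PiLp.inner_apply, dotProduct, mul_comm]
  · congr 1
    ext j
    simp

/-- A nonnegatively weighted sum of rank-one matrices plus a positive multiple of the identity
is positive definite. -/
lemma posDef_sum_smul_vecMulVec_add_smul_one {ι κ : Type*} [Fintype ι] [Fintype κ]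
    [DecidableEq κ] {a : ι → ℝ} (ha : ∀ i, 0 ≤ a i) (z : ι → κ → ℝ) {c : ℝ} (hc : 0 < c) :
    ((∑ i, a i • Matrix.vecMulVec (z i) (z i)) + c • (1 : Matrix κ κ ℝ)).PosDef := by
  refine Matrix.PosDef.posSemidef_add (Matrix.posSemidef_sum _ fun i _ => ?_)
    (Matrix.PosDef.one.smul hc)
  have h := (Matrix.posSemidef_vecMulVec_self_star (z i)).smul (ha i)
  simpa using h

/-- A solution of a positively regularized positive semidefinite system is bounded by the
right-hand side divided by the regularization parameter. -/
lemma mul_norm_le_norm_sum_smul_add_smul {ι E : Type*} [Fintype ι]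
    [NormedAddCommGroup E] [InnerProductSpace ℝ E] {a : ι → ℝ} (ha : ∀ i, 0 ≤ a i)
    (z : ι → E) (c : ℝ) (x : E) :
    c * ‖x‖ ≤ ‖(∑ i, (a i * ⟪x, z i⟫_ℝ) • z i) + c • x‖ := by
  rcases (norm_nonneg x).eq_or_lt with hx | hx
  · rw [← hx]; simp
  refine le_of_mul_le_mul_right ?_ hx
  have hsum : 0 ≤ ∑ i, a i * ⟪x, z i⟫_ℝ * ⟪z i, x⟫_ℝ := Finset.sum_nonneg fun i _ => by
    rw [mul_assoc, real_inner_comm x (z i)]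
    exact mul_nonneg (ha i) (mul_self_nonneg _)
  calc c * ‖x‖ * ‖x‖ ≤ ⟪(∑ i, (a i * ⟪x, z i⟫_ℝ) • z i) + c • x, x⟫_ℝ := by
        rw [inner_add_left, sum_inner, real_inner_smul_left, real_inner_self_eq_norm_mul_norm]
        simp only [real_inner_smul_left]
        linarith
    _ ≤ _ := real_inner_le_norm _ _

/-- Corollary 2 / batch node-removal worst-case bound.
Under the batch-removal regularized-empirical-risk model and regularity assumptions, if
all embeddings are bounded in norm by `F` and the removal set `S` has size `m`, then the
gradient residual of the unlearned model satisfies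
`‖∇L(w', D')‖ ≤ 4 γ₂ m² C₁² F³ / (λ² n)`. -/
theorem gradient_residual_batch_node_removal
    (d n m : ℕ) (hn : 1 ≤ n) (lam : ℝ) (hlam : 0 < lam)
    -- the loss `ℓ`, twice continuously differentiable in its first argument,
    -- with first and second partial derivatives `dl` and `ddl`
    (ℓ dl ddl : ℝ → ℝ → ℝ)
    (hdl : ∀ (yy s : ℝ), HasDerivAt (fun t => ℓ t yy) (dl s yy) s)
    (hddl : ∀ (yy s : ℝ), HasDerivAt (fun t => dl t yy) (ddl s yy) s)
    (hddl_cont : ∀ yy : ℝ, Continuous fun s => ddl s yy)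
    (hddl_nonneg : ∀ s yy : ℝ, 0 ≤ ddl s yy)
    -- the dataset `D = ((z i, y i))_i` and the updated dataset `D'`, obtained by
    -- replacing the embeddings `z i` by `z' i` for `i` in the removal set `S` of size `m`
    (z : Fin n → EuclideanSpace ℝ (Fin d)) (y : Fin n → ℝ)
    (S : Finset (Fin n)) (hS : S.card = m)
    (z' : Fin n → EuclideanSpace ℝ (Fin d)) (hz' : ∀ i ∉ S, z' i = z i)
    -- `wstar` minimizes the regularized empirical risk `L(·, D)`
    (wstar : EuclideanSpace ℝ (Fin d))
    (hwstar : ∀ w : EuclideanSpace ℝ (Fin d),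
      (∑ i, ℓ ⟪wstar, z i⟫_ℝ (y i)) + lam * n / 2 * ‖wstar‖ ^ 2 ≤
        (∑ i, ℓ ⟪w, z i⟫_ℝ (y i)) + lam * n / 2 * ‖w‖ ^ 2)
    -- regularity assumptions
    (C1 C2 γ1 γ2 : ℝ)
    (hC1pos : 0 < C1) (hC2pos : 0 < C2) (hγ1pos : 0 < γ1) (hγ2pos : 0 < γ2)
    (hC1 : ∀ (w : EuclideanSpace ℝ (Fin d)) (yy : ℝ) (i : Fin n),
      ‖dl ⟪w, z i⟫_ℝ yy • z i‖ ≤ C1 ∧ ‖dl ⟪w, z' i⟫_ℝ yy • z' i‖ ≤ C1)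
    (hC2 : ∀ s yy : ℝ, |dl s yy| ≤ C2)
    (hγ1 : ∀ (yy s t : ℝ), |dl s yy - dl t yy| ≤ γ1 * |s - t|)
    (hγ2 : ∀ (yy s t : ℝ), |ddl s yy - ddl t yy| ≤ γ2 * |s - t|)
    -- the additional boundedness assumptions
    (F : ℝ) (hF : 0 < F)
    (hzF : ∀ i, ‖z i‖ ≤ F) (hz'F : ∀ i, ‖z' i‖ ≤ F)
    -- the Hessian `H = ∇²L(wstar, D')`, the gradient difference `Δ`, and the
    -- unlearned model `w' = wstar + H⁻¹ Δ`
    (H : Matrix (Fin d) (Fin d) ℝ)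
    (hH : H = (∑ i, ddl ⟪wstar, z' i⟫_ℝ (y i) • Matrix.vecMulVec (z' i) (z' i)) +
      (lam * n) • (1 : Matrix (Fin d) (Fin d) ℝ))
    (Δ : EuclideanSpace ℝ (Fin d))
    (hΔ : Δ = ∑ i ∈ S, (dl ⟪wstar, z i⟫_ℝ (y i) • z i - dl ⟪wstar, z' i⟫_ℝ (y i) • z' i))
    (w' : EuclideanSpace ℝ (Fin d))
    (hw' : w' = wstar + Matrix.toEuclideanLin H⁻¹ Δ) :
    -- conclusion: bound on the gradient residual `‖∇L(w', D')‖`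
    ‖(∑ i, dl ⟪w', z' i⟫_ℝ (y i) • z' i) + (lam * n) • w'‖ ≤
      4 * γ2 * m ^ 2 * C1 ^ 2 * F ^ 3 / (lam ^ 2 * n) := by
  have hn0 : (0 : ℝ) < n := by exact_mod_cast hn
  have hc : 0 < lam * n := mul_pos hlam hn0
  set v := Matrix.toEuclideanLin H⁻¹ Δ with hv
  have hpd : H.PosDef :=
    hH ▸ posDef_sum_smul_vecMulVec_add_smul_one (fun i => hddl_nonneg _ _) (fun i => z' i) hc
  have hHv : Matrix.toEuclideanLin H v = Δ := by
    rw [hv]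
    simp [Matrix.toLpLin_apply, Matrix.mulVec_mulVec,
      Matrix.mul_nonsing_inv H ((Matrix.isUnit_iff_isUnit_det H).mp hpd.isUnit)]
  rw [hH, toEuclideanLin_sum_smul_vecMulVec_add_smul_one] at hHv
  have hΔnorm : ‖Δ‖ ≤ 2 * m * C1 := by
    rw [hΔ, ← hS]
    refine (norm_sum_le_of_le S fun i _ => (norm_sub_le _ _).trans
      (add_le_add (hC1 wstar (y i) i).1 (hC1 wstar (y i) i).2)).trans_eq ?_
    rw [Finset.sum_const, nsmul_eq_mul]
    ring
  have hvnorm : ‖v‖ ≤ 2 * m * C1 / (lam * n) := by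
    rw [le_div_iff₀' hc]
    refine le_trans ?_ hΔnorm
    rw [← hHv]
    exact mul_norm_le_norm_sum_smul_add_smul (fun i => hddl_nonneg _ _) z' _ v
  have hgrad := sum_smul_add_smul_eq_zero_of_forall_le
    (φ := fun i s => ℓ s (y i)) (φ' := fun i s => dl s (y i))
    (fun i s => hdl (y i) s) z (lam * n) wstar hwstar
  have hΔsum : Δ = (∑ i, dl ⟪wstar, z i⟫_ℝ (y i) • z i) -
      ∑ i, dl ⟪wstar, z' i⟫_ℝ (y i) • z' i := by
    rw [hΔ, ← Finset.sum_sub_distrib]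
    exact Finset.sum_subset (Finset.subset_univ S) fun i _ hi => by rw [hz' i hi, sub_self]
  have hres : (∑ i, dl ⟪w', z' i⟫_ℝ (y i) • z' i) + (lam * n) • w' =
      ∑ i, (dl ⟪w', z' i⟫_ℝ (y i) - dl ⟪wstar, z' i⟫_ℝ (y i) -
        ddl ⟪wstar, z' i⟫_ℝ (y i) * (⟪w', z' i⟫_ℝ - ⟪wstar, z' i⟫_ℝ)) • z' i := by
    have hinner : ∀ i, ⟪w', z' i⟫_ℝ - ⟪wstar, z' i⟫_ℝ = ⟪v, z' i⟫_ℝ := fun i => by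
      rw [hw', inner_add_left, add_sub_cancel_left]
    simp only [hinner, sub_smul, Finset.sum_sub_distrib]
    rw [eq_sub_of_add_eq hHv, hΔsum, eq_neg_of_add_eq_zero_left hgrad, hw', smul_add]
    abel
  rw [hres]
  calc _ ≤ ∑ _i : Fin n, γ2 * (F * (2 * m * C1 / (lam * n))) ^ 2 * F := by
        refine norm_sum_le_of_le _ fun i _ => ?_
        rw [norm_smul, Real.norm_eq_abs]
        have hinner : |⟪w', z' i⟫_ℝ - ⟪wstar, z' i⟫_ℝ| ≤ F * (2 * m * C1 / (lam * n)) := by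
          rw [hw', inner_add_left, add_sub_cancel_left, mul_comm F]
          exact (abs_real_inner_le_norm _ _).trans
            (mul_le_mul hvnorm (hz'F i) (norm_nonneg _) ((norm_nonneg _).trans hvnorm))
        have htaylor := abs_sub_sub_mul_le_of_lipschitz_deriv hγ2pos.le (hddl (y i)) (hγ2 (y i))
          ⟪wstar, z' i⟫_ℝ ⟪w', z' i⟫_ℝ
        refine mul_le_mul (htaylor.trans ?_) (hz'F i) (norm_nonneg _) (by positivity)
        gcongr
    _ = 4 * γ2 * m ^ 2 * C1 ^ 2 * F ^ 3 / (lam ^ 2 * n) := by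
        rw [Finset.sum_const, Finset.card_univ, Fintype.card_fin, nsmul_eq_mul]
        field_simp
        ring
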